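/- Let 0 < p < 1 be fixed. A.a.s., for every integer k ∈ [n − n^{1/4}·ln²n, n−2], every non-negative real d ≤ n^{1/4}·ln²n such that pk + d is an integer, and every (n−k−1)-subset U of the vertex set of G(n,p), there exists a vertex z ∉ U having exactly pk + d neighbors inside V ∖ U. -/

import Mathlib

open Classical Finset Filter

noncomputable def grWeight (n : ℕ) (p : ℝ) (G : SimpleGraph (Fin n)) : ℝ :=
  p ^ G.edgeFinset.card * (1 - p) ^ (n.choose 2 - G.edgeFinset.card)

noncomputable def grPr (n : ℕ) (p : ℝ) (A : Set (SimpleGraph (Fin n))) : ℝ :=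
  ∑ G : SimpleGraph (Fin n), if G ∈ A then grWeight n p G else 0

noncomputable def degIn {n : ℕ} (G : SimpleGraph (Fin n)) (S : Finset (Fin n)) (v : Fin n) : ℕ :=
  (S.filter (fun w => G.Adj v w)).card


noncomputable def bw (p : ℝ) (b : Bool) : ℝ := if b = true then p else 1 - p

noncomputable def bW {ι : Type} [Fintype ι] (p : ℝ) (ω : ι → Bool) : ℝ := ∏ i, bw p (ω i)

noncomputable def cnt {ι : Type} (S : Finset ι) (ω : ι → Bool) : ℕ :=
  (S.filter (fun i => ω i = true)).card

noncomputable def bin (p : ℝ) (N j : ℕ) : ℝ := (N.choose j : ℝ) * p ^ j * (1 - p) ^ (N - j)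

lemma bw_nonneg {p : ℝ} (hp0 : 0 < p) (hp1 : p < 1) (b : Bool) : 0 ≤ bw p b := by
  unfold bw; split_ifs <;> linarith

lemma bW_nonneg {ι : Type} [Fintype ι] {p : ℝ} (hp0 : 0 < p) (hp1 : p < 1) (ω : ι → Bool) :
    0 ≤ bW p ω := Finset.prod_nonneg fun _ _ => bw_nonneg hp0 hp1 _

lemma sum_prod_fun {ι κ R : Type} [Fintype ι] [DecidableEq ι] [Fintype κ] [CommRing R] (f : ι → κ → R) :
    ∑ ω : ι → κ, ∏ i, f i (ω i) = ∏ i, ∑ b, f i b := by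
  rw [Finset.prod_univ_sum]
  simp

lemma sum_bW {ι : Type} [Fintype ι] [DecidableEq ι] (p : ℝ) : ∑ ω : ι → Bool, bW p ω = 1 := by
  unfold bW
  rw [sum_prod_fun (fun (_ : ι) b => bw p b)]
  simp [bw]

lemma cnt_eq_sum {ι : Type} [Fintype ι] [DecidableEq ι] (S : Finset ι) (ω : ι → Bool) :
    (Polynomial.X : Polynomial ℝ) ^ cnt S ω
      = ∏ i, (if i ∈ S ∧ ω i = true then Polynomial.X else 1) := by
  have h : (Finset.univ.filter (fun i => i ∈ S ∧ ω i = true)) = S.filter (fun i => ω i = true) := by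
    ext i; simp
  unfold cnt
  rw [Finset.prod_ite, Finset.prod_const, Finset.prod_const_one, mul_one, h]

lemma binom_law {ι : Type} [Fintype ι] [DecidableEq ι] (p : ℝ) (S : Finset ι) (j : ℕ) :
    ∑ ω : ι → Bool, bW p ω * (if cnt S ω = j then 1 else 0) = bin p S.card j := by
  have key : ∑ ω : ι → Bool, Polynomial.C (bW p ω) * (Polynomial.X : Polynomial ℝ) ^ cnt S ω
      = (Polynomial.C p * Polynomial.X + Polynomial.C (1 - p)) ^ S.card := by
    have h1 : ∀ ω : ι → Bool, Polynomial.C (bW p ω) * (Polynomial.X : Polynomial ℝ) ^ cnt S ω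
        = ∏ i, (Polynomial.C (bw p (ω i)) * (if i ∈ S ∧ ω i = true then Polynomial.X else 1)) := by
      intro ω
      rw [cnt_eq_sum, Finset.prod_mul_distrib]
      unfold bW
      rw [map_prod]
    simp_rw [h1]
    rw [sum_prod_fun (fun i b => Polynomial.C (bw p b) *
      (if i ∈ S ∧ b = true then (Polynomial.X : Polynomial ℝ) else 1))]
    have h2 : ∀ i, (∑ b : Bool, Polynomial.C (bw p b) *
      (if i ∈ S ∧ b = true then (Polynomial.X : Polynomial ℝ) else 1))
        = if i ∈ S then (Polynomial.C p * Polynomial.X + Polynomial.C (1 - p)) else 1 := by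
      intro i
      by_cases hi : i ∈ S
      · simp [bw, hi]
      · simp [bw, hi]
    simp_rw [h2]
    rw [Finset.prod_ite]
    simp
  have h3 := congrArg (fun P => Polynomial.coeff P j) key
  simp only [Polynomial.finsetSum_coeff, Polynomial.coeff_C_mul, Polynomial.coeff_X_pow] at h3
  have h4 : ∀ ω : ι → Bool, (if j = cnt S ω then (1:ℝ) else 0) = if cnt S ω = j then 1 else 0 := by
    intro ω; simp only [eq_comm]
  simp_rw [h4] at h3
  rw [h3, add_pow, Polynomial.finsetSum_coeff]
  have h5 : ∀ m : ℕ, ((Polynomial.C p * Polynomial.X) ^ m * Polynomial.C (1 - p) ^ (S.card - m)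
      * ((S.card.choose m : ℕ) : Polynomial ℝ)).coeff j = if j = m then bin p S.card m else 0 := by
    intro m
    have : (Polynomial.C p * Polynomial.X) ^ m * Polynomial.C (1 - p) ^ (S.card - m)
      * ((S.card.choose m : ℕ) : Polynomial ℝ) = Polynomial.C (bin p S.card m) * Polynomial.X ^ m := by
      unfold bin
      simp only [map_mul, map_pow, map_natCast, mul_pow]
      ring
    rw [this, Polynomial.coeff_C_mul, Polynomial.coeff_X_pow]
    simp
  simp_rw [h5]
  rw [Finset.sum_ite_eq]
  split_ifs with h
  · rfl
  · unfold bin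
    rw [Nat.choose_eq_zero_of_lt (by simp at h; omega)]
    simp

lemma cnt_le {ι : Type} (S : Finset ι) (ω : ι → Bool) : cnt S ω ≤ S.card :=
  Finset.card_filter_le _ _

lemma binom_exp {ι : Type} [Fintype ι] [DecidableEq ι] (p : ℝ) (S : Finset ι) (f : ℕ → ℝ) :
    ∑ ω : ι → Bool, bW p ω * f (cnt S ω)
      = ∑ j ∈ Finset.range (S.card + 1), bin p S.card j * f j := by
  simp_rw [← binom_law p S, Finset.sum_mul]
  rw [Finset.sum_comm]
  refine Finset.sum_congr rfl fun ω _ => ?_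
  rw [Finset.sum_eq_single (cnt S ω)]
  · simp
  · intro b _ hb; simp [hb.symm]
  · intro h; exact absurd (Finset.mem_range.2 (Nat.lt_succ_of_le (cnt_le S ω))) h

lemma bin_sum (p : ℝ) (N : ℕ) : ∑ j ∈ Finset.range (N + 1), bin p N j = 1 := by
  have := add_pow p (1 - p) N
  simp only [add_sub_cancel, one_pow] at this
  rw [this]
  refine Finset.sum_congr rfl fun j _ => ?_
  unfold bin; ring

lemma bin_var (p : ℝ) (N : ℕ) :
    ∑ j ∈ Finset.range (N + 1), bin p N j * ((j:ℝ) - p * N) ^ 2 = N * p * (1 - p) := by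
  have h := bernsteinPolynomial.variance ℝ N
  have h2 := congrArg (Polynomial.eval p) h
  simp only [Polynomial.eval_finsetSum, bernsteinPolynomial, Polynomial.eval_mul,
    Polynomial.eval_pow, Polynomial.eval_sub, Polynomial.eval_X,
    Polynomial.eval_natCast, Polynomial.eval_one, nsmul_eq_mul] at h2
  rw [← h2]
  refine Finset.sum_congr rfl fun j _ => ?_
  unfold bin; ring

lemma bin_nonneg {p : ℝ} (hp0 : 0 < p) (hp1 : p < 1) (N j : ℕ) : 0 ≤ bin p N j := by
  unfold bin
  have : 0 ≤ 1 - p := by linarith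
  positivity

lemma bin_step (p : ℝ) (N j : ℕ) (hj : j < N) :
    bin p N (j + 1) * (((j:ℝ) + 1) * (1 - p)) = bin p N j * (((N:ℝ) - j) * p) := by
  have h := Nat.choose_succ_right_eq N j
  have h' : (N.choose (j+1) : ℝ) * ((j:ℝ) + 1) = N.choose j * ((N:ℝ) - j) := by
    rw [← Nat.cast_sub hj.le]
    exact_mod_cast h
  unfold bin
  have e : N - j = (N - (j + 1)) + 1 := by omega
  rw [e, pow_succ, pow_succ]
  linear_combination (p ^ j * p * (1 - p) ^ (N - (j + 1)) * (1 - p)) * h'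

lemma bin_ratio {p : ℝ} (hp0 : 0 < p) (hp1 : p < 1) {C x δ : ℝ} (hC : 0 < C) (hx : 0 < x) {N j : ℕ}
    (hN : x ^ 2 = N) (hδ : δ * (p * (1 - p) * x) = C) (hδ2 : δ ≤ 1 / 2)
    (h1 : p * N - C * x ≤ j) (h2 : ((j + 1 : ℕ) : ℝ) ≤ p * N + C * x) :
    (1 - δ) * bin p N j ≤ bin p N (j + 1) ∧ (1 - δ) * bin p N (j + 1) ≤ bin p N j := by
  have hq : 0 < 1 - p := by linarith
  push_cast at h2
  have hδ0 : 0 < δ := by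
    by_contra h
    push Not at h
    have : δ * (p * (1 - p) * x) ≤ 0 := mul_nonpos_of_nonpos_of_nonneg h (by positivity)
    linarith
  have hCx : C * x = δ * (p * (1 - p)) * N := by rw [← hδ, ← hN]; ring
  have hN0 : (0:ℝ) < N := by rw [← hN]; positivity
  have hjN : (j : ℝ) + 1 ≤ N := by
    have : δ * (p * (1 - p)) * N ≤ (1 - p) * N := by
      apply mul_le_mul_of_nonneg_right _ hN0.le
      have e1 : δ * p ≤ 1 := by nlinarith
      calc δ * (p * (1 - p)) = (δ * p) * (1 - p) := by ring
        _ ≤ 1 * (1 - p) := mul_le_mul_of_nonneg_right e1 hq.le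
        _ = 1 - p := one_mul _
    nlinarith
  have hjN' : j < N := by
    have : j + 1 ≤ N := by exact_mod_cast hjN
    omega
  have hs := bin_step p N j hjN'
  set P := bin p N j
  set Q := bin p N (j+1)
  have hP : 0 ≤ P := bin_nonneg hp0 hp1 _ _
  have hQ : 0 ≤ Q := bin_nonneg hp0 hp1 _ _
  set s := ((j:ℝ) + 1) * (1 - p) with hsdef
  set t := ((N:ℝ) - j) * p with htdef
  have hs0 : 0 < s := by positivity
  have ht0 : 0 < t := by
    apply mul_pos _ hp0; linarith
  set y := C * x with hy
  have hy0 : 0 < y := by positivity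
  have s1 : s ≤ p * (1 - p) * N + (1 - p) * y := by
    have := mul_le_mul_of_nonneg_right h2 hq.le
    rw [hsdef]; linarith
  have s2 : p * (1 - p) * N - (1 - p) * y ≤ s := by
    have := mul_le_mul_of_nonneg_right h1 hq.le
    rw [hsdef]; nlinarith
  have t1 : t ≤ p * (1 - p) * N + p * y := by
    have := mul_le_mul_of_nonneg_right h1 hp0.le
    rw [htdef]; linarith
  have t2 : p * (1 - p) * N - p * y ≤ t := by
    have := mul_le_mul_of_nonneg_right h2 hp0.le
    rw [htdef]; nlinarith
  have k1 : (1 - δ) * s ≤ t := by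
    have := mul_le_mul_of_nonneg_left s1 (by linarith : 0 ≤ 1 - δ)
    have : 0 ≤ δ * ((1 - p) * y) := by positivity
    nlinarith
  have k2 : (1 - δ) * t ≤ s := by
    have := mul_le_mul_of_nonneg_left t1 (by linarith : 0 ≤ 1 - δ)
    have : 0 ≤ δ * (p * y) := by positivity
    nlinarith
  constructor
  · apply le_of_mul_le_mul_right _ hs0
    calc (1 - δ) * P * s = ((1 - δ) * s) * P := by ring
      _ ≤ t * P := mul_le_mul_of_nonneg_right k1 hP
      _ = Q * s := by linarith
  · apply le_of_mul_le_mul_right _ ht0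
    calc (1 - δ) * Q * t = ((1 - δ) * t) * Q := by ring
      _ ≤ s * Q := mul_le_mul_of_nonneg_right k2 hQ
      _ = P * t := by linarith

lemma bin_chain {p : ℝ} (hp0 : 0 < p) (hp1 : p < 1) {C x δ : ℝ} (hC : 0 < C) (hx : 0 < x) {N : ℕ}
    (hN : x ^ 2 = N) (hδ : δ * (p * (1 - p) * x) = C) (hδ2 : δ ≤ 1 / 2) (j l : ℕ)
    (h1 : p * N - C * x ≤ j) (h2 : ((j + l : ℕ) : ℝ) ≤ p * N + C * x) :
    (1 - δ) ^ l * bin p N j ≤ bin p N (j + l) ∧ (1 - δ) ^ l * bin p N (j + l) ≤ bin p N j := by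
  induction l with
  | zero => simp
  | succ l ih =>
    push_cast at h2
    obtain ⟨i1, i2⟩ := ih (by push_cast; linarith)
    obtain ⟨r1, r2⟩ := bin_ratio (j := j + l) hp0 hp1 hC hx hN hδ hδ2
      (by push_cast; have : (0:ℝ) ≤ l := Nat.cast_nonneg _
          linarith) (by push_cast; linarith)
    have hd : 0 ≤ 1 - δ := by linarith
    have e : j + (l + 1) = j + l + 1 := by ring
    rw [e]
    constructor
    · calc (1 - δ) ^ (l + 1) * bin p N j = (1 - δ) * ((1 - δ) ^ l * bin p N j) := by ring
        _ ≤ (1 - δ) * bin p N (j + l) := mul_le_mul_of_nonneg_left i1 hd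
        _ ≤ _ := r1
    · calc (1 - δ) ^ (l + 1) * bin p N (j + l + 1) = (1 - δ) ^ l * ((1 - δ) * bin p N (j + l + 1)) := by ring
        _ ≤ (1 - δ) ^ l * bin p N (j + l) := mul_le_mul_of_nonneg_left r2 (by positivity)
        _ ≤ _ := i2

lemma one_sub_ge_exp {δ : ℝ} (h0 : 0 ≤ δ) (h : δ ≤ 1 / 2) : Real.exp (-(2 * δ)) ≤ 1 - δ := by
  rw [Real.exp_neg]
  have := Real.add_one_le_exp (2 * δ)
  have h3 : (Real.exp (2 * δ))⁻¹ ≤ (2 * δ + 1)⁻¹ := inv_anti₀ (by linarith) this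
  refine h3.trans ?_
  rw [inv_le_iff_one_le_mul₀ (by linarith)]
  nlinarith

lemma window_card (N : ℕ) (y x : ℝ) (hx : 1 ≤ x) :
    (((Finset.range (N + 1)).filter (fun j : ℕ => |(j:ℝ) - y| ≤ x)).card : ℝ) ≤ 3 * x := by
  rcases Finset.eq_empty_or_nonempty ((Finset.range (N + 1)).filter (fun j : ℕ => |(j:ℝ) - y| ≤ x)) with h | h
  · rw [h]; simp; linarith
  · obtain ⟨i, hi⟩ := h
    have hi2 := abs_le.1 (Finset.mem_filter.1 hi).2
    have hyx : 0 ≤ y + x := by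
      have : (0:ℝ) ≤ i := Nat.cast_nonneg _
      linarith
    have hsub : ((Finset.range (N + 1)).filter (fun j : ℕ => |(j:ℝ) - y| ≤ x)) ⊆ Finset.Icc ⌈y - x⌉₊ ⌊y + x⌋₊ := by
      intro j hj
      have hj2 := abs_le.1 (Finset.mem_filter.1 hj).2
      rw [Finset.mem_Icc]
      exact ⟨Nat.ceil_le.2 (by linarith), Nat.le_floor (by linarith)⟩
    have hc := Finset.card_le_card hsub
    rw [Nat.card_Icc] at hc
    have hle : ⌈y - x⌉₊ ≤ ⌊y + x⌋₊ := by
      have := Finset.mem_Icc.1 (hsub hi)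
      omega
    have hc' : (((Finset.range (N + 1)).filter (fun j : ℕ => |(j:ℝ) - y| ≤ x)).card : ℝ) ≤ ⌊y + x⌋₊ + 1 - ⌈y - x⌉₊ := by
      have e := (Nat.cast_le (α := ℝ)).2 hc
      rw [Nat.cast_sub (by omega)] at e
      push_cast at e
      exact e
    have a1 := Nat.floor_le hyx
    have a2 := Nat.le_ceil (y - x)
    linarith

lemma llt {p : ℝ} (hp0 : 0 < p) (hp1 : p < 1) {C : ℝ} (hC : 1 ≤ C) :
    ∃ c : ℝ, 0 < c ∧ ∃ N0 : ℕ, ∀ N : ℕ, N0 ≤ N → ∀ m : ℕ, |(m:ℝ) - p * N| ≤ C * √N →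
      c / √N ≤ bin p N m := by
  have hq : 0 < 1 - p := by linarith
  have hpq : 0 < p * (1 - p) := by positivity
  set D := C / (p * (1 - p)) with hD
  have hD0 : 0 < D := by positivity
  refine ⟨Real.exp (-(4 * C * D)) / 4, by positivity, ⌈(2 * D) ^ 2⌉₊ + 1, ?_⟩
  intro N hN m hm
  have hN1 : (2 * D) ^ 2 ≤ N := by
    have := Nat.le_ceil ((2 * D) ^ 2)
    have h2 : ((⌈(2 * D) ^ 2⌉₊ : ℕ) : ℝ) ≤ N := by exact_mod_cast (by omega)
    linarith
  have hN2 : (1:ℝ) ≤ N := by exact_mod_cast (by omega)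
  set x := √(N:ℝ) with hx
  have hx1 : 1 ≤ x := by rw [hx]; exact Real.one_le_sqrt.2 hN2
  have hx0 : 0 < x := by linarith
  have hxN : x ^ 2 = N := Real.sq_sqrt (by linarith)
  have hxD : 2 * D ≤ x := Real.le_sqrt_of_sq_le hN1
  set δ := D / x with hδ
  have hδ0 : 0 < δ := by positivity
  have hδ2 : δ ≤ 1 / 2 := by
    rw [hδ, div_le_iff₀ hx0]; linarith
  have hδC : δ * (p * (1 - p) * x) = C := by
    rw [hδ, hD]; field_simp
  have hm2 := abs_le.1 hm
  have hcomp : ∀ j : ℕ, |(j:ℝ) - p * N| ≤ x → bin p N j * Real.exp (-(4 * C * D)) ≤ bin p N m := by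
    intro j hj
    have hj2 := abs_le.1 hj
    have hxC : x ≤ C * x := by nlinarith
    have hpow : ∀ l : ℕ, (l:ℝ) ≤ 2 * C * x → Real.exp (-(4 * C * D)) ≤ (1 - δ) ^ l := by
      intro l hl
      calc Real.exp (-(4 * C * D)) ≤ Real.exp (l * (-(2 * δ))) := by
            apply Real.exp_le_exp.2
            have : (l:ℝ) * δ ≤ 2 * C * x * δ := mul_le_mul_of_nonneg_right hl hδ0.le
            have e : 2 * C * x * δ = 2 * C * D := by rw [hδ]; field_simp
            linarith
        _ = Real.exp (-(2 * δ)) ^ l := Real.exp_nat_mul _ _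
        _ ≤ _ := pow_le_pow_left₀ (Real.exp_pos _).le (one_sub_ge_exp hδ0.le hδ2) _
    have hb := bin_nonneg hp0 hp1 N j
    rcases le_total j m with h | h
    · obtain ⟨l, rfl⟩ := Nat.exists_eq_add_of_le h
      have := (bin_chain hp0 hp1 (by linarith) hx0 hxN hδC hδ2 j l (by linarith) (by linarith)).1
      push_cast at hm2
      have h3 := hpow l (by linarith)
      nlinarith
    · obtain ⟨l, rfl⟩ := Nat.exists_eq_add_of_le h
      have := (bin_chain hp0 hp1 (by linarith) hx0 hxN hδC hδ2 m l (by linarith) (by linarith)).2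
      push_cast at hj2
      have h3 := hpow l (by linarith)
      nlinarith
  set W := (Finset.range (N + 1)).filter (fun j : ℕ => |(j:ℝ) - p * N| ≤ x) with hW
  have hsum := Finset.sum_filter_add_sum_filter_not (Finset.range (N+1))
    (fun j : ℕ => |(j:ℝ) - p * N| ≤ x) (fun j => bin p N j)
  rw [bin_sum] at hsum
  have hcheb : ∑ j ∈ (Finset.range (N + 1)).filter (fun j : ℕ => ¬ |(j:ℝ) - p * N| ≤ x), bin p N j ≤ 1/4 := by
    have h1 : (∑ j ∈ (Finset.range (N + 1)).filter (fun j : ℕ => ¬ |(j:ℝ) - p * N| ≤ x), bin p N j) * N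
        ≤ N * p * (1 - p) := by
      rw [← bin_var, Finset.sum_mul]
      refine le_trans (Finset.sum_le_sum (g := fun j => bin p N j * ((j:ℝ) - p * N) ^ 2) ?_) ?_
      · intro j hj
        have h := (Finset.mem_filter.1 hj).2
        apply mul_le_mul_of_nonneg_left _ (bin_nonneg hp0 hp1 _ _)
        push Not at h
        rw [← sq_abs ((j:ℝ) - p * N)]
        refine hxN.symm.le.trans ?_
        exact pow_le_pow_left₀ hx0.le h.le 2
      · apply Finset.sum_le_sum_of_subset_of_nonneg (Finset.filter_subset _ _)
        intro i _ _
        exact mul_nonneg (bin_nonneg hp0 hp1 _ _) (sq_nonneg _)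
    have h2 : p * (1 - p) ≤ 1 / 4 := by nlinarith [sq_nonneg (p - 1/2)]
    by_contra h
    have h := lt_of_not_ge h
    nlinarith
  have hlow : (3:ℝ)/4 ≤ ∑ j ∈ W, bin p N j := by linarith
  have hup : (∑ j ∈ W, bin p N j) * Real.exp (-(4 * C * D)) ≤ W.card * bin p N m := by
    rw [Finset.sum_mul, ← nsmul_eq_mul]
    apply Finset.sum_le_card_nsmul
    intro j hj
    exact hcomp j (Finset.mem_filter.1 hj).2
  have hcard : (W.card : ℝ) ≤ 3 * x := window_card N (p * N) x hx1
  have hbm := bin_nonneg hp0 hp1 N m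
  rw [div_le_iff₀ hx0]
  have he := Real.exp_pos (-(4 * C * D))
  nlinarith [mul_le_mul_of_nonneg_right hcard hbm, mul_le_mul_of_nonneg_right hlow he.le]

noncomputable def edg {n : ℕ} (a : ℕ) (ω1 : Fin n × Fin n → Bool) (ω2 : Fin n → Fin n → Bool)
    (u v : Fin n) : Bool := if u.val < a ∧ a ≤ v.val then ω2 u v else ω1 (u, v)

def gam {n : ℕ} (a : ℕ) (ω1 : Fin n × Fin n → Bool) (ω2 : Fin n → Fin n → Bool) :
    SimpleGraph (Fin n) where
  Adj u v := u ≠ v ∧ edg a ω1 ω2 (min u v) (max u v) = true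
  symm := ⟨fun u v h => ⟨h.1.symm, by rw [min_comm, max_comm]; exact h.2⟩⟩
  loopless := ⟨fun u h => h.1 rfl⟩

lemma card_pairs {n : ℕ} (G : SimpleGraph (Fin n)) :
    ((Finset.univ : Finset (Fin n × Fin n)).filter (fun x => x.1 < x.2 ∧ G.Adj x.1 x.2)).card
      = G.edgeFinset.card := by
  refine Finset.card_bij (fun x _ => s(x.1, x.2)) ?_ ?_ ?_
  · intro x hx
    simp only [Finset.mem_filter, Finset.mem_univ, true_and] at hx
    simpa using hx.2
  · rintro ⟨a, b⟩ hx ⟨c, d⟩ hy h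
    simp only [Finset.mem_filter, Finset.mem_univ, true_and] at hx hy
    simp only [Sym2.eq_iff] at h
    rcases h with ⟨rfl, rfl⟩ | ⟨rfl, rfl⟩
    · rfl
    · exact absurd hx.1 (lt_asymm hy.1)
  · intro e
    induction e using Sym2.ind with
    | _ u v =>
      intro he
      have he : G.Adj u v := by simpa using he
      rcases lt_or_gt_of_ne he.ne with h | h
      · exact ⟨(u, v), by simp [h, he], rfl⟩
      · exact ⟨(v, u), by simp [h, he.symm], Sym2.eq_swap⟩

lemma card_pairs_all (n : ℕ) :
    ((Finset.univ : Finset (Fin n × Fin n)).filter (fun x => x.1 < x.2)).card = n.choose 2 := by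
  have h := card_pairs (⊤ : SimpleGraph (Fin n))
  have h2 : (⊤ : SimpleGraph (Fin n)).edgeFinset.card = n.choose 2 := by
    have := SimpleGraph.card_edgeFinset_top_eq_card_choose_two (V := Fin n)
    rw [Fintype.card_fin] at this
    convert this
  rw [← h2]
  trans
  swap
  · convert h
  congr 1
  ext x
  simp only [Finset.mem_filter, Finset.mem_univ, true_and, SimpleGraph.top_adj]
  exact ⟨fun h => ⟨h, h.ne⟩, fun h => h.1⟩

lemma weight_prod {n : ℕ} (p : ℝ) (G : SimpleGraph (Fin n)) :
    ∏ x : Fin n × Fin n, (if x.1 < x.2 then (if G.Adj x.1 x.2 then p else 1 - p) else 1)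
      = grWeight n p G := by
  rw [Finset.prod_ite, Finset.prod_const_one, mul_one, Finset.prod_ite, Finset.prod_const,
    Finset.prod_const, Finset.filter_filter, Finset.filter_filter]
  have h1 := card_pairs G
  have h2 := card_pairs_all n
  have h3 := Finset.card_filter_add_card_filter_not
    (s := (Finset.univ : Finset (Fin n × Fin n)).filter (fun x => x.1 < x.2))
    (fun x => G.Adj x.1 x.2)
  rw [Finset.filter_filter, Finset.filter_filter] at h3
  unfold grWeight
  rw [← h1, ← h2, ← h3, Nat.add_sub_cancel_left]

noncomputable def rW {n : ℕ} (p : ℝ) (ω2 : Fin n → Fin n → Bool) : ℝ := ∏ z, bW p (ω2 z)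

lemma rW_nonneg {n : ℕ} {p : ℝ} (hp0 : 0 < p) (hp1 : p < 1) (ω : Fin n → Fin n → Bool) :
    0 ≤ rW p ω := Finset.prod_nonneg fun _ _ => bW_nonneg hp0 hp1 _

lemma sum_rW {n : ℕ} (p : ℝ) : ∑ ω : Fin n → Fin n → Bool, rW p ω = 1 := by
  unfold rW
  rw [sum_prod_fun (fun (_ : Fin n) (r : Fin n → Bool) => bW p r)]
  simp [sum_bW]

lemma gam_eq_iff {n : ℕ} (a : ℕ) (ω1 : Fin n × Fin n → Bool) (ω2 : Fin n → Fin n → Bool)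
    (G : SimpleGraph (Fin n)) :
    gam a ω1 ω2 = G ↔ ∀ u v, u < v → (edg a ω1 ω2 u v = true ↔ G.Adj u v) := by
  constructor
  · rintro rfl u v h
    simp [gam, min_eq_left h.le, max_eq_right h.le, h.ne]
  · intro h
    ext u v
    rcases lt_trichotomy u v with huv | rfl | huv
    · rw [← h u v huv]
      simp [gam, min_eq_left huv.le, max_eq_right huv.le, huv.ne]
    · simp
    · rw [G.adj_comm, ← h v u huv]
      simp [gam, min_eq_right huv.le, max_eq_left huv.le, huv.ne']

noncomputable def ff1 {n : ℕ} (a : ℕ) (G : SimpleGraph (Fin n)) (x : Fin n × Fin n) (b : Bool) : ℝ :=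
  if x.1 < x.2 ∧ ¬ (x.1.val < a ∧ a ≤ x.2.val) then (if (b = true ↔ G.Adj x.1 x.2) then 1 else 0) else 1

noncomputable def ff2 {n : ℕ} (a : ℕ) (G : SimpleGraph (Fin n)) (u v : Fin n) (b : Bool) : ℝ :=
  if u < v ∧ (u.val < a ∧ a ≤ v.val) then (if (b = true ↔ G.Adj u v) then 1 else 0) else 1

lemma ind_gam {n : ℕ} (a : ℕ) (ω1 : Fin n × Fin n → Bool) (ω2 : Fin n → Fin n → Bool)
    (G : SimpleGraph (Fin n)) :
    (if gam a ω1 ω2 = G then (1:ℝ) else 0)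
      = (∏ x, ff1 a G x (ω1 x)) * ∏ u, ∏ v, ff2 a G u v (ω2 u v) := by
  rw [← Fintype.prod_prod_type' (f := fun u v => ff2 a G u v (ω2 u v)), ← Finset.prod_mul_distrib]
  have h : ∀ x : Fin n × Fin n, ff1 a G x (ω1 x) * ff2 a G x.1 x.2 (ω2 x.1 x.2)
      = if (x.1 < x.2 → (edg a ω1 ω2 x.1 x.2 = true ↔ G.Adj x.1 x.2)) then 1 else 0 := by
    rintro ⟨u, v⟩
    unfold ff1 ff2 edg
    by_cases h1 : u < v <;> by_cases h2 : (u.val < a ∧ a ≤ v.val) <;> simp [h1, h2]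
  simp_rw [h]
  rw [Finset.prod_ite_zero, Finset.prod_const_one]
  congr 1
  rw [gam_eq_iff]
  simp

lemma weight_gam {n : ℕ} (p : ℝ) (a : ℕ) (G : SimpleGraph (Fin n)) :
    ∑ ω1 : Fin n × Fin n → Bool, ∑ ω2 : Fin n → Fin n → Bool,
      bW p ω1 * rW p ω2 * (if gam a ω1 ω2 = G then (1:ℝ) else 0) = grWeight n p G := by
  have h : ∀ (ω1 : Fin n × Fin n → Bool) (ω2 : Fin n → Fin n → Bool),
      bW p ω1 * rW p ω2 * (if gam a ω1 ω2 = G then (1:ℝ) else 0)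
      = (∏ x, bw p (ω1 x) * ff1 a G x (ω1 x)) * (∏ u, ∏ v, bw p (ω2 u v) * ff2 a G u v (ω2 u v)) := by
    intro ω1 ω2
    rw [ind_gam]
    simp_rw [Finset.prod_mul_distrib]
    unfold rW bW
    ring
  simp_rw [h, ← Finset.mul_sum]
  rw [← Finset.sum_mul, sum_prod_fun (fun x b => bw p b * ff1 a G x b),
    sum_prod_fun (fun u (r : Fin n → Bool) => ∏ v, bw p (r v) * ff2 a G u v (r v))]
  simp_rw [fun u => sum_prod_fun (fun v b => bw p b * ff2 a G u v b)]
  rw [← Fintype.prod_prod_type' (f := fun u v => ∑ b, bw p b * ff2 a G u v b),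
    ← Finset.prod_mul_distrib, ← weight_prod]
  refine Finset.prod_congr rfl ?_
  rintro ⟨u, v⟩ _
  unfold ff1 ff2 bw
  by_cases h1 : u < v <;> by_cases h2 : (u.val < a ∧ a ≤ v.val) <;> by_cases h3 : G.Adj u v <;>
    simp [h1, h2, h3]

lemma grPr_eq {n : ℕ} (p : ℝ) (a : ℕ) (A : Set (SimpleGraph (Fin n))) :
    grPr n p A = ∑ ω1 : Fin n × Fin n → Bool, ∑ ω2 : Fin n → Fin n → Bool,
      bW p ω1 * rW p ω2 * (if gam a ω1 ω2 ∈ A then (1:ℝ) else 0) := by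
  unfold grPr
  have h : ∀ (ω1 : Fin n × Fin n → Bool) (ω2 : Fin n → Fin n → Bool),
      bW p ω1 * rW p ω2 * (if gam a ω1 ω2 ∈ A then (1:ℝ) else 0)
      = ∑ G : SimpleGraph (Fin n), if G ∈ A then
         bW p ω1 * rW p ω2 * (if gam a ω1 ω2 = G then (1:ℝ) else 0) else 0 := by
    intro ω1 ω2
    rw [Finset.sum_eq_single (gam a ω1 ω2)]
    · by_cases h : gam a ω1 ω2 ∈ A <;> simp [h]
    · intro b _ hb; simp [hb.symm]
    · simp
  simp_rw [h]
  rw [Finset.sum_congr rfl (fun ω1 _ => Finset.sum_comm), Finset.sum_comm]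
  refine Finset.sum_congr rfl fun G _ => ?_
  by_cases hG : G ∈ A
  · simp only [hG, if_true]
    rw [weight_gam]
  · simp [hG]

lemma grPr_compl {n : ℕ} (p : ℝ) (A : Set (SimpleGraph (Fin n))) :
    grPr n p A = 1 - grPr n p Aᶜ := by
  have h : grPr n p A + grPr n p Aᶜ = 1 := by
    have e1 : ∑ ω1 : Fin n × Fin n → Bool, ∑ ω2 : Fin n → Fin n → Bool, bW p ω1 * rW p ω2 = 1 := by
      simp_rw [← Finset.mul_sum, sum_rW, mul_one, sum_bW]
    rw [grPr_eq p 0, grPr_eq p 0, ← Finset.sum_add_distrib, ← e1]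
    refine Finset.sum_congr rfl fun ω1 _ => ?_
    rw [← Finset.sum_add_distrib]
    refine Finset.sum_congr rfl fun ω2 _ => ?_
    by_cases h : gam 0 ω1 ω2 ∈ A <;> simp [h, e1]
  linarith

def lowS (n a : ℕ) : Finset (Fin n) := Finset.univ.filter (fun v => v.val < a)

lemma mem_lowS {n a : ℕ} {v : Fin n} : v ∈ lowS n a ↔ v.val < a := by simp [lowS]

lemma card_lowS {n a : ℕ} (h : a ≤ n) : (lowS n a).card = a := by
  unfold lowS
  rw [Fin.card_filter_val_lt]
  exact min_eq_right h

noncomputable def dIn {n : ℕ} (ω1 : Fin n × Fin n → Bool) (S : Finset (Fin n)) (z : Fin n) : ℕ :=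
  (S.filter (fun y => y ≠ z ∧ ω1 (min z y, max z y) = true)).card

lemma deg_split {n : ℕ} (a : ℕ) (ω1 : Fin n × Fin n → Bool) (ω2 : Fin n → Fin n → Bool)
    (U : Finset (Fin n)) (z : Fin n) (hz : z.val < a) :
    degIn (gam a ω1 ω2) Uᶜ z = dIn ω1 (lowS n a \ U) z + cnt ((lowS n a)ᶜ \ U) (ω2 z) := by
  unfold degIn dIn cnt
  rw [← Finset.card_union_of_disjoint]
  · congr 1
    ext y
    simp only [Finset.mem_filter, Finset.mem_union, Finset.mem_sdiff, Finset.mem_compl, mem_lowS]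
    by_cases hy : y.val < a
    · have : ¬ ((min z y).val < a ∧ a ≤ (max z y).val) := by
        rintro ⟨_, h⟩
        rcases max_choice z y with h' | h' <;> rw [h'] at h <;> omega
      have he : edg a ω1 ω2 (min z y) (max z y) = ω1 (min z y, max z y) := by
        unfold edg; rw [if_neg this]
      simp [gam, he, hy, ne_comm]
    · have hzy : z < y := by
        rw [Fin.lt_def]; omega
      simp [gam, edg, hy, min_eq_left hzy.le, max_eq_right hzy.le, hz, hzy.ne, not_lt.1 hy]
  · rw [Finset.disjoint_left]
    intro y hy hy2
    simp only [Finset.mem_filter, Finset.mem_sdiff, Finset.mem_compl] at hy hy2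
    exact hy2.1.1 hy.1.1

lemma dIn_moment {n : ℕ} {p : ℝ} (hp0 : 0 < p) (hp1 : p < 1) {a : ℕ} (ha : a ≤ n) (z : Fin n)
    (hz : z.val < a) :
    ∑ ω1 : Fin n × Fin n → Bool, bW p ω1 * ((dIn ω1 (lowS n a) z : ℝ) - p * ((a:ℝ) - 1)) ^ 2 ≤ (a : ℝ) := by
  set f : Fin n → Fin n × Fin n := fun y => (min z y, max z y) with hf
  have hinj : Function.Injective f := by
    intro y y' h
    simp only [hf, Prod.mk.injEq] at h
    rcases le_total z y with h1 | h1 <;> rcases le_total z y' with h2 | h2 <;>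
      simp only [min_eq_left, max_eq_right, min_eq_right, max_eq_left, h1, h2] at h <;> grind
  set S := ((lowS n a).erase z).image f with hS
  have hc : S.card = a - 1 := by
    rw [hS, Finset.card_image_of_injective _ hinj, Finset.card_erase_of_mem (mem_lowS.2 hz), card_lowS ha]
  have hd : ∀ ω1, dIn ω1 (lowS n a) z = cnt S ω1 := by
    intro ω1
    unfold dIn cnt
    rw [hS, Finset.filter_image, Finset.card_image_of_injective _ hinj]
    congr 1
    ext y
    simp only [Finset.mem_filter, Finset.mem_erase, hf]
    tauto
  simp_rw [hd]
  have h1 : ((a - 1 : ℕ) : ℝ) = (a:ℝ) - 1 := by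
    rw [Nat.cast_sub (by omega)]; simp
  rw [binom_exp p S (fun j => ((j:ℝ) - p * ((a:ℝ) - 1)) ^ 2), hc, ← h1, bin_var]
  have h2 : p * (1 - p) ≤ 1 := by nlinarith
  have h3 : ((a - 1 : ℕ) : ℝ) ≤ a := by rw [h1]; linarith
  have h4 : (0:ℝ) ≤ ((a - 1 : ℕ) : ℝ) := Nat.cast_nonneg _
  nlinarith

noncomputable def badS {n : ℕ} (p : ℝ) (a : ℕ) (ω1 : Fin n × Fin n → Bool) : Finset (Fin n) :=
  (lowS n a).filter (fun z => √(n:ℝ) < |(dIn ω1 (lowS n a) z : ℝ) - p * ((a:ℝ) - 1)|)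

lemma bad_prob {n : ℕ} {p : ℝ} (hp0 : 0 < p) (hp1 : p < 1) {a : ℕ} (ha : a ≤ n) (ha0 : 0 < a) :
    ∑ ω1 : Fin n × Fin n → Bool, bW p ω1 * (if a ≤ 2 * (badS p a ω1).card then (1:ℝ) else 0)
      ≤ 2 * a / n := by
  have hn : (0:ℝ) < n := by exact_mod_cast (by omega)
  have ha' : (0:ℝ) < a := by exact_mod_cast ha0
  have h1 : ∀ ω1 : Fin n × Fin n → Bool,
      (if a ≤ 2 * (badS p a ω1).card then (1:ℝ) else 0) * (a * n) ≤
        2 * ∑ z ∈ lowS n a, ((dIn ω1 (lowS n a) z : ℝ) - p * ((a:ℝ) - 1)) ^ 2 := by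
    intro ω1
    have h0 : 0 ≤ ∑ z ∈ lowS n a, ((dIn ω1 (lowS n a) z : ℝ) - p * ((a:ℝ) - 1)) ^ 2 :=
      Finset.sum_nonneg fun _ _ => sq_nonneg _
    split_ifs with h
    · have h2 : ((badS p a ω1).card : ℝ) * n ≤
        ∑ z ∈ lowS n a, ((dIn ω1 (lowS n a) z : ℝ) - p * ((a:ℝ) - 1)) ^ 2 := by
        calc ((badS p a ω1).card : ℝ) * n = (badS p a ω1).card • (n:ℝ) := by simp
          _ ≤ ∑ z ∈ badS p a ω1, ((dIn ω1 (lowS n a) z : ℝ) - p * ((a:ℝ) - 1)) ^ 2 := by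
            apply Finset.card_nsmul_le_sum
            intro z hz
            have hz := (Finset.mem_filter.1 hz).2
            rw [← sq_abs]
            calc (n:ℝ) = √(n:ℝ) ^ 2 := (Real.sq_sqrt hn.le).symm
              _ ≤ _ := pow_le_pow_left₀ (Real.sqrt_nonneg _) hz.le 2
          _ ≤ _ := Finset.sum_le_sum_of_subset_of_nonneg (Finset.filter_subset _ _)
              (fun _ _ _ => sq_nonneg _)
      have h3 : (a:ℝ) ≤ 2 * ((badS p a ω1).card : ℝ) := by exact_mod_cast h
      nlinarith
    · linarith
  have h2 : (∑ ω1 : Fin n × Fin n → Bool, bW p ω1 * (if a ≤ 2 * (badS p a ω1).card then (1:ℝ) else 0)) * (a * n)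
      ≤ 2 * (a * a) := by
    calc _ ≤ ∑ ω1 : Fin n × Fin n → Bool, bW p ω1 *
          (2 * ∑ z ∈ lowS n a, ((dIn ω1 (lowS n a) z : ℝ) - p * ((a:ℝ) - 1)) ^ 2) := by
          rw [Finset.sum_mul]
          refine Finset.sum_le_sum fun ω1 _ => ?_
          rw [mul_assoc]
          exact mul_le_mul_of_nonneg_left (h1 ω1) (bW_nonneg hp0 hp1 _)
      _ = 2 * ∑ z ∈ lowS n a, ∑ ω1 : Fin n × Fin n → Bool, bW p ω1 *
          ((dIn ω1 (lowS n a) z : ℝ) - p * ((a:ℝ) - 1)) ^ 2 := by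
          rw [Finset.sum_comm, Finset.mul_sum]
          refine Finset.sum_congr rfl fun ω1 _ => ?_
          rw [Finset.mul_sum, Finset.mul_sum, Finset.mul_sum]
          refine Finset.sum_congr rfl fun z _ => ?_
          ring
      _ ≤ 2 * ∑ z ∈ lowS n a, (a:ℝ) := by
          apply mul_le_mul_of_nonneg_left _ (by norm_num)
          exact Finset.sum_le_sum fun z hz => dIn_moment hp0 hp1 ha z (mem_lowS.1 hz)
      _ = 2 * (a * a) := by rw [Finset.sum_const, card_lowS ha]; simp
  rw [le_div_iff₀ hn]
  nlinarith

lemma cond_bound {n : ℕ} {p : ℝ} (hp0 : 0 < p) (hp1 : p < 1) {a : ℕ}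
    (ω1 : Fin n × Fin n → Bool) (U : Finset (Fin n)) (m : ℕ) (T : Finset (Fin n)) (j : Fin n → ℕ)
    (ε : ℝ)
    (hT : ∀ z ∈ T, z.val < a ∧ z ∉ U ∧ dIn ω1 (lowS n a \ U) z + j z = m ∧
      ε ≤ bin p ((lowS n a)ᶜ \ U).card (j z)) :
    ∑ ω2 : Fin n → Fin n → Bool, rW p ω2 *
      (if ∀ z, z ∉ U → degIn (gam a ω1 ω2) Uᶜ z ≠ m then (1:ℝ) else 0) ≤ (1 - ε) ^ T.card := by
  set S := (lowS n a)ᶜ \ U with hS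
  set h : Fin n → (Fin n → Bool) → ℝ := fun z r =>
    if z ∈ T then 1 - (if cnt S r = j z then 1 else 0) else 1 with hh
  have h01 : ∀ z r, 0 ≤ h z r := by
    intro z r; simp only [hh]; split_ifs <;> norm_num
  calc _ ≤ ∑ ω2 : Fin n → Fin n → Bool, ∏ z, (bW p (ω2 z) * h z (ω2 z)) := by
        refine Finset.sum_le_sum fun ω2 _ => ?_
        rw [Finset.prod_mul_distrib]
        refine mul_le_mul_of_nonneg_left ?_ (rW_nonneg hp0 hp1 _)
        split_ifs with hc
        · apply le_of_eq
          symm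
          apply Finset.prod_eq_one
          intro z _
          simp only [hh]
          split_ifs with h1 h2
          · exfalso
            obtain ⟨t1, t2, t3, _⟩ := hT z h1
            apply hc z t2
            rw [deg_split a ω1 ω2 U z t1, ← hS, h2, t3]
          · simp
          · rfl
        · exact Finset.prod_nonneg fun z _ => h01 z _
    _ = ∏ z, ∑ r, bW p r * h z r := sum_prod_fun (fun z r => bW p r * h z r)
    _ = ∏ z, if z ∈ T then 1 - bin p S.card (j z) else 1 := by
        refine Finset.prod_congr rfl fun z _ => ?_
        by_cases hz : z ∈ T
        · simp only [hh, hz, if_true, mul_sub, mul_one, Finset.sum_sub_distrib, sum_bW]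
          rw [binom_law]
        · simp [hh, hz, sum_bW]
    _ = ∏ z ∈ T, (1 - bin p S.card (j z)) := by
        rw [Finset.prod_ite_mem, Finset.univ_inter]
    _ ≤ ∏ z ∈ T, (1 - ε) := by
        apply Finset.prod_le_prod
        · intro z hz
          have : bin p S.card (j z) ≤ 1 := by
            rcases le_or_gt (j z) S.card with h | h
            · rw [← bin_sum p S.card]
              exact Finset.single_le_sum (f := fun j => bin p S.card j)
                (fun i _ => bin_nonneg hp0 hp1 _ _) (Finset.mem_range.2 (by omega))
            · unfold bin; rw [Nat.choose_eq_zero_of_lt h]; simp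
          linarith
        · intro z hz
          linarith [(hT z hz).2.2.2]
    _ = _ := by simp

lemma fixed_bound {p : ℝ} (hp0 : 0 < p) (hp1 : p < 1) {c : ℝ} (hc0 : 0 < c) {N0 : ℕ}
    (hllt : ∀ N : ℕ, N0 ≤ N → ∀ m : ℕ, |(m:ℝ) - p * N| ≤ 5 * √N → c / √N ≤ bin p N m)
    {n a : ℕ} {K : ℝ} (ha : a ≤ n) (hn : 0 < n) (hK : K ≤ √(n:ℝ))
    (hN : (n:ℝ) / 2 ≤ n - a - K) (hN0 : (N0:ℝ) ≤ n / 2) (hpn : 6 * √(n:ℝ) < p * n)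
    (hcn : c ≤ √(n:ℝ))
    (ω1 : Fin n × Fin n → Bool) (hbad : 2 * (badS p a ω1).card < a)
    (U : Finset (Fin n)) (hU : (U.card : ℝ) ≤ K) (m : ℕ)
    (hm0 : 0 ≤ (m:ℝ) - p * (n - U.card - 1)) (hm1 : (m:ℝ) - p * (n - U.card - 1) ≤ K) :
    ∑ ω2 : Fin n → Fin n → Bool, rW p ω2 *
      (if ∀ z, z ∉ U → degIn (gam a ω1 ω2) Uᶜ z ≠ m then (1:ℝ) else 0)
        ≤ Real.exp (-(c / √(n:ℝ)) * (a / 2 - K)) := by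
  have hn' : (0:ℝ) < n := by exact_mod_cast hn
  have hs0 : 0 < √(n:ℝ) := Real.sqrt_pos.2 hn'
  set ε := c / √(n:ℝ) with hε
  have hε0 : 0 < ε := by positivity
  have hε1 : ε ≤ 1 := by rw [hε, div_le_one hs0]; exact hcn
  set T := (lowS n a \ badS p a ω1) \ U with hT
  set N := ((lowS n a)ᶜ \ U).card with hNdef
  set u := (lowS n a ∩ U).card with hu
  have huU : u ≤ U.card := Finset.card_le_card Finset.inter_subset_right
  have huU' : (u:ℝ) ≤ U.card := by exact_mod_cast huU
  have hNeq : (N:ℝ) = n - a - U.card + u := by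
    have h1 : N + (lowS n a ∪ U).card = n := by
      have e : (lowS n a)ᶜ \ U = (lowS n a ∪ U)ᶜ := by
        ext x; simp
      rw [hNdef, e, Finset.card_compl_add_card, Fintype.card_fin]
    have h2 := Finset.card_union_add_card_inter (lowS n a) U
    rw [card_lowS ha] at h2
    have h1' : (N:ℝ) + ((lowS n a ∪ U).card : ℝ) = n := by exact_mod_cast h1
    have h2' : ((lowS n a ∪ U).card : ℝ) + u = a + U.card := by exact_mod_cast h2
    linarith
  have hu0 : (0:ℝ) ≤ u := Nat.cast_nonneg _
  have hNn : (n:ℝ) / 2 ≤ N := by linarith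
  have hNle : (N:ℝ) ≤ n := by
    have : N ≤ n := by
      have := Finset.card_le_univ ((lowS n a)ᶜ \ U)
      rwa [Fintype.card_fin] at this
    exact_mod_cast this
  have hNpos : (0:ℝ) < N := by linarith
  have hkey : ∀ z ∈ T, dIn ω1 (lowS n a \ U) z + (m - dIn ω1 (lowS n a \ U) z) = m ∧
      ε ≤ bin p N (m - dIn ω1 (lowS n a \ U) z) := by
    intro z hz
    simp only [hT, Finset.mem_sdiff] at hz
    obtain ⟨⟨hz1, hz2⟩, hz3⟩ := hz
    have hgood : |(dIn ω1 (lowS n a) z : ℝ) - p * ((a:ℝ) - 1)| ≤ √(n:ℝ) := by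
      by_contra h
      exact hz2 (Finset.mem_filter.2 ⟨hz1, lt_of_not_ge h⟩)
    have hg := abs_le.1 hgood
    set d0 := dIn ω1 (lowS n a) z with hd0
    set dA := dIn ω1 (lowS n a \ U) z with hdA
    have h1 : dA ≤ d0 := by
      apply Finset.card_le_card
      exact Finset.filter_subset_filter _ Finset.sdiff_subset
    have h2 : d0 ≤ dA + u := by
      rw [hd0, hdA, hu]
      unfold dIn
      refine le_trans (Finset.card_le_card ?_) (Finset.card_union_le _ _)
      intro y hy
      simp only [Finset.mem_filter, Finset.mem_union, Finset.mem_sdiff, Finset.mem_inter] at hy ⊢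
      tauto
    have h1' : (dA:ℝ) ≤ d0 := by exact_mod_cast h1
    have h2' : (d0:ℝ) ≤ dA + u := by exact_mod_cast h2
    have hpu : p * u ≤ u := by nlinarith
    have hpu0 : 0 ≤ p * u := by positivity
    have hdev : |(m:ℝ) - dA - p * N| ≤ 3 * √(n:ℝ) := by
      rw [hNeq, abs_le]
      constructor <;> nlinarith
    have hdev' := abs_le.1 hdev
    have hpN : p * (n / 2) ≤ p * N := mul_le_mul_of_nonneg_left hNn hp0.le
    have hle : dA ≤ m := by
      have : (dA:ℝ) ≤ m := by linarith
      exact_mod_cast this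
    refine ⟨by omega, ?_⟩
    have h35 : 3 * √(n:ℝ) ≤ 5 * √(N:ℝ) := by
      apply (pow_le_pow_iff_left₀ (by positivity) (by positivity) two_ne_zero).1
      rw [mul_pow, mul_pow, Real.sq_sqrt hn'.le, Real.sq_sqrt hNpos.le]
      linarith
    have := hllt N (by
      have : (N0:ℝ) ≤ N := by linarith
      exact_mod_cast this) (m - dA) (by
        rw [Nat.cast_sub hle]
        linarith)
    refine le_trans ?_ this
    rw [hε]
    exact div_le_div_of_nonneg_left hc0.le (Real.sqrt_pos.2 hNpos) (Real.sqrt_le_sqrt hNle)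
  have hcb := cond_bound hp0 hp1 (a := a) ω1 U m T (fun z => m - dIn ω1 (lowS n a \ U) z) ε (by
    intro z hz
    have hz' := hz
    simp only [hT, Finset.mem_sdiff] at hz'
    exact ⟨mem_lowS.1 hz'.1.1, hz'.2, (hkey z hz).1, (hkey z hz).2⟩)
  refine hcb.trans ?_
  have hTc : (a:ℝ) / 2 - K ≤ T.card := by
    have h1 : a ≤ T.card + U.card + (badS p a ω1).card := by
      have e1 := Finset.le_card_sdiff U (lowS n a \ badS p a ω1)
      have e2 := Finset.le_card_sdiff (badS p a ω1) (lowS n a)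
      rw [card_lowS ha] at e2
      rw [← hT] at e1
      omega
    have h1' : (a:ℝ) ≤ T.card + U.card + (badS p a ω1).card := by exact_mod_cast h1
    have h2' : 2 * ((badS p a ω1).card : ℝ) < a := by exact_mod_cast hbad
    linarith
  calc (1 - ε) ^ T.card ≤ Real.exp (-ε) ^ T.card := by
        apply pow_le_pow_left₀ (by linarith)
        have := Real.add_one_le_exp (-ε)
        linarith
    _ = Real.exp (T.card * (-ε)) := (Real.exp_nat_mul _ _).symm
    _ ≤ _ := by
        apply Real.exp_le_exp.2
        nlinarith

def failSet (n : ℕ) (p K : ℝ) : Set (SimpleGraph (Fin n)) :=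
  {G | ∃ (U : Finset (Fin n)) (m : ℕ), (U.card : ℝ) ≤ K ∧ 0 ≤ (m:ℝ) - p * (n - U.card - 1) ∧
    (m:ℝ) - p * (n - U.card - 1) ≤ K ∧ ∀ z, z ∉ U → degIn G Uᶜ z ≠ m}

lemma card_small_sets (n L : ℕ) (hn : 1 ≤ n) :
    ((Finset.univ : Finset (Finset (Fin n))).filter (fun U => U.card ≤ L)).card ≤ (L + 1) * n ^ L := by
  have hsub : (Finset.univ : Finset (Finset (Fin n))).filter (fun U => U.card ≤ L)
      ⊆ (Finset.range (L + 1)).biUnion (fun i => Finset.powersetCard i Finset.univ) := by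
    intro U hU
    simp only [Finset.mem_filter, Finset.mem_univ, true_and] at hU
    simp only [Finset.mem_biUnion, Finset.mem_range, Finset.mem_powersetCard, Finset.subset_univ, true_and]
    exact ⟨U.card, by omega, rfl⟩
  refine (Finset.card_le_card hsub).trans (Finset.card_biUnion_le.trans ?_)
  have : ∀ i ∈ Finset.range (L + 1), (Finset.powersetCard i (Finset.univ : Finset (Fin n))).card ≤ n ^ L := by
    intro i hi
    rw [Finset.card_powersetCard, Finset.card_univ, Fintype.card_fin]
    refine (Nat.choose_le_pow n i).trans ?_
    exact Nat.pow_le_pow_right hn (by simp at hi; omega)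
  refine (Finset.sum_le_card_nsmul _ _ _ this).trans ?_
  simp

lemma total_bound {p : ℝ} (hp0 : 0 < p) (hp1 : p < 1) {c : ℝ} (hc0 : 0 < c) {N0 : ℕ}
    (hllt : ∀ N : ℕ, N0 ≤ N → ∀ m : ℕ, |(m:ℝ) - p * N| ≤ 5 * √N → c / √N ≤ bin p N m)
    {n a : ℕ} {K : ℝ} (ha : a ≤ n) (ha0 : 0 < a) (hK0 : 0 ≤ K) (hK : K ≤ √(n:ℝ))
    (hN : (n:ℝ) / 2 ≤ n - a - K) (hN0 : (N0:ℝ) ≤ n / 2) (hpn : 6 * √(n:ℝ) < p * n)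
    (hcn : c ≤ √(n:ℝ)) :
    grPr n p (failSet n p K) ≤ 2 * a / n +
      ((⌊K⌋₊ + 1) * n ^ ⌊K⌋₊ * (2 * n + 1) : ℕ) * Real.exp (-(c / √(n:ℝ)) * (a / 2 - K)) := by
  have hn : 0 < n := by omega
  have hn' : (0:ℝ) < n := by exact_mod_cast hn
  set X := Real.exp (-(c / √(n:ℝ)) * (a / 2 - K)) with hX
  set Q : ℕ := (⌊K⌋₊ + 1) * n ^ ⌊K⌋₊ * (2 * n + 1) with hQ
  rw [grPr_eq p a]
  have hmain : ∀ ω1 : Fin n × Fin n → Bool,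
      ∑ ω2 : Fin n → Fin n → Bool, rW p ω2 * (if gam a ω1 ω2 ∈ failSet n p K then (1:ℝ) else 0)
        ≤ (if a ≤ 2 * (badS p a ω1).card then (1:ℝ) else 0) + Q * X := by
    intro ω1
    have hQX : 0 ≤ (Q:ℝ) * X := by positivity
    split_ifs with hb
    · have : ∑ ω2 : Fin n → Fin n → Bool, rW p ω2 * (if gam a ω1 ω2 ∈ failSet n p K then (1:ℝ) else 0)
          ≤ ∑ ω2 : Fin n → Fin n → Bool, rW p ω2 := by
        refine Finset.sum_le_sum fun ω2 _ => ?_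
        have := rW_nonneg hp0 hp1 ω2
        split_ifs <;> linarith
      rw [sum_rW] at this
      linarith
    · rw [zero_add]
      set I := (((Finset.univ : Finset (Finset (Fin n))).filter (fun U => U.card ≤ ⌊K⌋₊)) ×ˢ
        Finset.range (2 * n + 1)).filter (fun x => 0 ≤ (x.2:ℝ) - p * (n - x.1.card - 1) ∧
          (x.2:ℝ) - p * (n - x.1.card - 1) ≤ K) with hI
      have hIc : (I.card : ℝ) ≤ Q := by
        have : I.card ≤ Q := by
          refine (Finset.card_filter_le _ _).trans ?_
          rw [Finset.card_product, Finset.card_range]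
          exact Nat.mul_le_mul_right _ (card_small_sets n _ hn)
        exact_mod_cast this
      calc _ ≤ ∑ ω2 : Fin n → Fin n → Bool, ∑ x ∈ I, rW p ω2 *
            (if ∀ z, z ∉ x.1 → degIn (gam a ω1 ω2) x.1ᶜ z ≠ x.2 then (1:ℝ) else 0) := by
            refine Finset.sum_le_sum fun ω2 _ => ?_
            rw [← Finset.mul_sum]
            refine mul_le_mul_of_nonneg_left ?_ (rW_nonneg hp0 hp1 _)
            have hnn : ∀ x ∈ I, (0:ℝ) ≤ (if ∀ z, z ∉ x.1 → degIn (gam a ω1 ω2) x.1ᶜ z ≠ x.2 then (1:ℝ) else 0) := by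
              intro x _; split_ifs <;> norm_num
            split_ifs with hf
            · obtain ⟨U, m, hU, hm0, hm1, hz⟩ := hf
              have hmem : (U, m) ∈ I := by
                rw [hI]
                simp only [Finset.mem_filter, Finset.mem_product, Finset.mem_univ, true_and,
                  Finset.mem_range]
                refine ⟨⟨Nat.le_floor hU, ?_⟩, hm0, hm1⟩
                have h1 : √(n:ℝ) ≤ n := by
                  have : (1:ℝ) ≤ n := by exact_mod_cast hn
                  rw [Real.sqrt_le_left hn'.le]
                  nlinarith
                have hUc : (0:ℝ) ≤ U.card := Nat.cast_nonneg _
                have h2 : (m:ℝ) ≤ 2 * n := by nlinarith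
                have h3 : m ≤ 2 * n := by exact_mod_cast h2
                omega
              have := Finset.single_le_sum hnn hmem
              simp only at this
              rw [if_pos hz] at this
              exact this
            · exact Finset.sum_nonneg hnn
        _ = ∑ x ∈ I, ∑ ω2 : Fin n → Fin n → Bool, rW p ω2 *
            (if ∀ z, z ∉ x.1 → degIn (gam a ω1 ω2) x.1ᶜ z ≠ x.2 then (1:ℝ) else 0) := Finset.sum_comm
        _ ≤ ∑ x ∈ I, X := by
            refine Finset.sum_le_sum fun x hx => ?_
            rw [hI] at hx
            simp only [Finset.mem_filter, Finset.mem_product, Finset.mem_univ, true_and] at hx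
            exact fixed_bound hp0 hp1 hc0 hllt ha hn hK hN hN0 hpn hcn ω1 (by omega) x.1
              ((Nat.le_floor_iff hK0).1 hx.1.1) x.2 hx.2.1 hx.2.2
        _ = I.card * X := by simp
        _ ≤ Q * X := mul_le_mul_of_nonneg_right hIc (Real.exp_pos _).le
  calc _ = ∑ ω1 : Fin n × Fin n → Bool, bW p ω1 * ∑ ω2 : Fin n → Fin n → Bool, rW p ω2 *
        (if gam a ω1 ω2 ∈ failSet n p K then (1:ℝ) else 0) := by
        refine Finset.sum_congr rfl fun ω1 _ => ?_
        rw [Finset.mul_sum]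
        refine Finset.sum_congr rfl fun ω2 _ => ?_
        ring
    _ ≤ ∑ ω1 : Fin n × Fin n → Bool, bW p ω1 *
        ((if a ≤ 2 * (badS p a ω1).card then (1:ℝ) else 0) + Q * X) :=
        Finset.sum_le_sum fun ω1 _ => mul_le_mul_of_nonneg_left (hmain ω1) (bW_nonneg hp0 hp1 _)
    _ = ∑ ω1 : Fin n × Fin n → Bool, bW p ω1 * (if a ≤ 2 * (badS p a ω1).card then (1:ℝ) else 0)
        + Q * X := by
        simp_rw [mul_add]
        rw [Finset.sum_add_distrib, ← Finset.sum_mul, sum_bW, one_mul]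
    _ ≤ _ := by
        have := bad_prob hp0 hp1 ha ha0
        linarith

lemma grPr_mono {n : ℕ} {p : ℝ} (hp0 : 0 < p) (hp1 : p < 1) {A B : Set (SimpleGraph (Fin n))}
    (h : A ⊆ B) : grPr n p A ≤ grPr n p B := by
  unfold grPr
  refine Finset.sum_le_sum fun G _ => ?_
  have hq : 0 ≤ 1 - p := by linarith
  have hw : 0 ≤ grWeight n p G := by unfold grWeight; positivity
  by_cases h1 : G ∈ A
  · simp [h1, h h1]
  · simp only [h1, if_false]; split_ifs <;> simp [hw]

lemma grPr_nonneg {n : ℕ} {p : ℝ} (hp0 : 0 < p) (hp1 : p < 1) (A : Set (SimpleGraph (Fin n))) :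
    0 ≤ grPr n p A := by
  unfold grPr
  refine Finset.sum_nonneg fun G _ => ?_
  have hq : 0 ≤ 1 - p := by linarith
  have hw : 0 ≤ grWeight n p G := by unfold grWeight; positivity
  split_ifs <;> simp [hw]

lemma num_bound {p : ℝ} (hp0 : 0 < p) (hp1 : p < 1) {c : ℝ} (hc0 : 0 < c) {N0 : ℕ}
    (hllt : ∀ N : ℕ, N0 ≤ N → ∀ m : ℕ, |(m:ℝ) - p * N| ≤ 5 * √N → c / √N ≤ bin p N m)
    {n : ℕ} {y K : ℝ} (hy : (n:ℝ) = y ^ 64) (hlog : Real.log n ≤ y) (hlog0 : 0 ≤ Real.log n)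
    (hK : K = y ^ 16 * Real.log n ^ 2) (y1 : 100 ≤ y) (y2 : 2 * (N0:ℝ) ≤ y) (y3 : 6 / p < y)
    (y4 : c ≤ y) (y5 : 4 * (4 + c) / c ≤ y) :
    grPr n p (failSet n p K) ≤ (4 + 4 / c) / y := by
  have hy0 : 0 < y := by linarith
  have hy1 : 1 ≤ y := by linarith
  have hmono : ∀ {i j : ℕ}, i ≤ j → y ^ i ≤ y ^ j := fun h => pow_le_pow_right₀ hy1 h
  have hsq : √(n:ℝ) = y ^ 32 := by
    rw [hy, show y ^ 64 = (y ^ 32) ^ 2 by ring]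
    exact Real.sqrt_sq (by positivity)
  have hK0 : 0 ≤ K := by rw [hK]; positivity
  have hK18 : K ≤ y ^ 18 := by
    rw [hK, show y ^ 18 = y ^ 16 * y ^ 2 by ring]
    gcongr
  set a := ⌈y ^ 56⌉₊ with ha
  have ha1 : y ^ 56 ≤ a := Nat.le_ceil _
  have ha2 : (a:ℝ) < y ^ 56 + 1 := Nat.ceil_lt_add_one (by positivity)
  have h57 : 100 * y ^ 56 ≤ y ^ 57 := by
    rw [show y ^ 57 = y * y ^ 56 by ring]; gcongr
  have h5764 : y ^ 57 ≤ y ^ 64 := hmono (by norm_num)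
  have h1856 : y ^ 18 ≤ y ^ 56 := hmono (by norm_num)
  have h156 : 1 ≤ y ^ 56 := one_le_pow₀ hy1
  have h164 : y ≤ y ^ 64 := by simpa using hmono (i := 1) (j := 64) (by norm_num)
  have h132 : y ≤ y ^ 32 := by simpa using hmono (i := 1) (j := 32) (by norm_num)
  have han : a ≤ n := by
    have : (a:ℝ) ≤ n := by rw [hy]; linarith
    exact_mod_cast this
  have ha0 : 0 < a := by
    have : (0:ℝ) < a := by linarith
    exact_mod_cast this
  have hpn : 6 * √(n:ℝ) < p * n := by
    rw [hsq, hy]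
    have h6 : 6 < p * y := by
      rw [div_lt_iff₀ hp0] at y3; linarith
    have : y * y ^ 32 ≤ y ^ 64 := by
      rw [show y * y ^ 32 = y ^ 33 by ring]; exact hmono (by norm_num)
    have h32 : 0 < y ^ 32 := by positivity
    nlinarith
  have htb := total_bound (K := K) hp0 hp1 hc0 hllt han ha0 hK0
    (by rw [hsq]; exact hK18.trans (hmono (by norm_num)))
    (by rw [hy]; linarith) (by rw [hy]; linarith) hpn (by rw [hsq]; linarith)
  refine htb.trans ?_
  have hn0 : (0:ℝ) < n := by rw [hy]; positivity
  have p1 : 2 * (a:ℝ) / n ≤ 4 / y := by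
    rw [hy, div_le_div_iff₀ (by positivity) hy0]
    have : 2 * (a:ℝ) ≤ 4 * y ^ 56 := by linarith
    calc 2 * (a:ℝ) * y ≤ 4 * y ^ 56 * y := by gcongr
      _ = 4 * y ^ 57 := by ring
      _ ≤ 4 * y ^ 64 := by linarith
  have p2 : (((⌊K⌋₊ + 1) * n ^ ⌊K⌋₊ * (2 * n + 1) : ℕ) : ℝ) ≤ Real.exp ((3 + K) * Real.log n) := by
    have hfl : (⌊K⌋₊ : ℝ) ≤ K := Nat.floor_le hK0
    have e1 : (⌊K⌋₊ : ℝ) + 1 ≤ n := by rw [hy]; linarith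
    have e2 : 2 * (n:ℝ) + 1 ≤ n ^ 2 := by
      have : (100:ℝ) ≤ n := by rw [hy]; linarith
      nlinarith
    have hexp : Real.exp (Real.log n) = n := Real.exp_log hn0
    push_cast
    calc ((⌊K⌋₊ : ℝ) + 1) * (n:ℝ) ^ ⌊K⌋₊ * (2 * n + 1) ≤ n * (n:ℝ) ^ ⌊K⌋₊ * n ^ 2 := by gcongr
      _ = (n:ℝ) ^ (⌊K⌋₊ + 3) := by ring
      _ = Real.exp (((⌊K⌋₊ + 3 : ℕ) : ℝ) * Real.log n) := by rw [Real.exp_nat_mul, hexp]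
      _ ≤ _ := by
        apply Real.exp_le_exp.2
        apply mul_le_mul_of_nonneg_right _ hlog0
        push_cast; linarith
  have p3 : -(c / √(n:ℝ)) * (a / 2 - K) ≤ c - c / 2 * y ^ 24 := by
    rw [hsq]
    have h32 : 0 < y ^ 32 := by positivity
    have e : y ^ 56 / 2 - y ^ 32 ≤ (a:ℝ) / 2 - K := by
      have : y ^ 18 ≤ y ^ 32 := hmono (by norm_num)
      linarith
    have e2 : c / y ^ 32 * (y ^ 56 / 2 - y ^ 32) ≤ c / y ^ 32 * ((a:ℝ) / 2 - K) :=
      mul_le_mul_of_nonneg_left e (by positivity)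
    have e3 : c / y ^ 32 * (y ^ 56 / 2 - y ^ 32) = c / 2 * y ^ 24 - c := by
      field_simp
    linarith
  have p4 : (3 + K) * Real.log n + c ≤ c / 4 * y ^ 24 := by
    have f1 : (3 + K) * Real.log n ≤ (3 + y ^ 18) * y := by gcongr
    have f2 : y ≤ y ^ 19 := by simpa using hmono (i := 1) (j := 19) (by norm_num)
    have f3 : 1 ≤ y ^ 19 := one_le_pow₀ hy1
    have f4 : 4 + c ≤ c / 4 * y := by
      rw [div_le_iff₀ hc0] at y5; linarith
    have f5 : (4 + c) * y ^ 19 ≤ c / 4 * y * y ^ 19 := by gcongr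
    have f6 : y ^ 20 ≤ y ^ 24 := hmono (by norm_num)
    have f7 : c / 4 * y ^ 20 ≤ c / 4 * y ^ 24 := by gcongr
    nlinarith
  have p5 : (((⌊K⌋₊ + 1) * n ^ ⌊K⌋₊ * (2 * n + 1) : ℕ) : ℝ) *
      Real.exp (-(c / √(n:ℝ)) * (a / 2 - K)) ≤ 4 / c / y := by
    calc _ ≤ Real.exp ((3 + K) * Real.log n) * Real.exp (c - c / 2 * y ^ 24) :=
          mul_le_mul p2 (Real.exp_le_exp.2 p3) (Real.exp_pos _).le (Real.exp_pos _).le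
      _ = Real.exp ((3 + K) * Real.log n + (c - c / 2 * y ^ 24)) := (Real.exp_add _ _).symm
      _ ≤ Real.exp (-(c / 4 * y)) := by
          apply Real.exp_le_exp.2
          have : y ≤ y ^ 24 := by simpa using hmono (i := 1) (j := 24) (by norm_num)
          have : c / 4 * y ≤ c / 4 * y ^ 24 := by gcongr
          linarith
      _ = (Real.exp (c / 4 * y))⁻¹ := Real.exp_neg _
      _ ≤ (c / 4 * y)⁻¹ := by
          apply inv_anti₀ (by positivity)
          have := Real.add_one_le_exp (c / 4 * y)
          linarith
      _ = 4 / c / y := by field_simp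
  calc _ ≤ 4 / y + 4 / c / y := add_le_add p1 p5
    _ = _ := by ring

/-- Claim 5: a.a.s., for every `k ∈ [n − n^{1/4}ln²n, n−2]`, every real `0 ≤ d ≤ n^{1/4}ln²n`
such that `pk + d` is an integer, and every `(n−k−1)`-set `U`, there is a vertex `z ∉ U` with
exactly `pk + d` neighbors in `V ∖ U`. -/
theorem aas_degree_realizable_outside (p : ℝ) (hp0 : 0 < p) (hp1 : p < 1) :
    Tendsto (fun n : ℕ =>
        grPr n p {G | ∀ k : ℕ,
          (n : ℝ) - (n : ℝ) ^ ((1 : ℝ) / 4) * (Real.log n) ^ 2 ≤ (k : ℝ) → k ≤ n - 2 →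
          ∀ d : ℝ, 0 ≤ d → d ≤ (n : ℝ) ^ ((1 : ℝ) / 4) * (Real.log n) ^ 2 →
          (∃ m : ℕ, (m : ℝ) = p * k + d) →
          ∀ U : Finset (Fin n), U.card = n - k - 1 →
            ∃ z : Fin n, z ∉ U ∧ (degIn G Uᶜ z : ℝ) = p * k + d})
      atTop (nhds 1) := by
  obtain ⟨c, hc0, N0, hllt⟩ := llt hp0 hp1 (C := 5) (by norm_num)
  have hytop : Tendsto (fun n : ℕ => (n:ℝ) ^ ((1:ℝ)/64)) atTop atTop :=
    (tendsto_rpow_atTop (by norm_num)).comp tendsto_natCast_atTop_atTop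
  have hlow : Tendsto (fun n : ℕ => 1 - (4 + 4 / c) / (n:ℝ) ^ ((1:ℝ)/64)) atTop (nhds 1) := by
    have := (hytop.const_div_atTop (4 + 4 / c)).const_sub 1
    simpa using this
  refine tendsto_of_tendsto_of_tendsto_of_le_of_le' hlow tendsto_const_nhds ?_ ?_
  · have hlog : ∀ᶠ n : ℕ in atTop, Real.log n ≤ (n:ℝ) ^ ((1:ℝ)/64) := by
      have h := (isLittleO_log_rpow_atTop (r := (1:ℝ)/64) (by norm_num)).bound (c := 1) (by norm_num)
      have h2 := tendsto_natCast_atTop_atTop (R := ℝ) |>.eventually h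
      filter_upwards [h2] with n hn
      rw [one_mul, Real.norm_eq_abs, Real.norm_eq_abs,
        abs_of_nonneg (Real.rpow_nonneg (Nat.cast_nonneg _) _)] at hn
      exact (le_abs_self _).trans hn
    filter_upwards [hlog, hytop.eventually_ge_atTop 100, hytop.eventually_ge_atTop (2 * (N0:ℝ)),
      hytop.eventually_gt_atTop (6 / p), hytop.eventually_ge_atTop c,
      hytop.eventually_ge_atTop (4 * (4 + c) / c), eventually_ge_atTop 2] with n h1 h2 h3 h4 h5 h6 hn
    have hn0 : (0:ℝ) ≤ n := Nat.cast_nonneg _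
    have hn1 : (1:ℝ) ≤ n := by exact_mod_cast (by omega)
    rw [grPr_compl]
    have hy : (n:ℝ) = ((n:ℝ) ^ ((1:ℝ)/64)) ^ 64 := by
      rw [← Real.rpow_natCast, ← Real.rpow_mul hn0]; norm_num
    have hy16 : (n:ℝ) ^ ((1:ℝ)/4) = ((n:ℝ) ^ ((1:ℝ)/64)) ^ 16 := by
      rw [← Real.rpow_natCast, ← Real.rpow_mul hn0]; norm_num
    have hb := num_bound (n := n) (K := (n : ℝ) ^ ((1 : ℝ) / 4) * (Real.log n) ^ 2) hp0 hp1 hc0 hllt hy h1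
      (Real.log_nonneg hn1) (by rw [hy16]) h2 h3 h4 h5 h6
    refine sub_le_sub_left (le_trans (grPr_mono hp0 hp1 ?_) hb) 1
    intro G hG
    simp only [Set.mem_compl_iff, Set.mem_ofPred_eq] at hG
    push Not at hG
    obtain ⟨k, hk1, hk2, d, hd0, hd1, ⟨m, hm⟩, U, hU, hz⟩ := hG
    have hUc : (U.card : ℝ) = n - k - 1 := by
      have : U.card + k + 1 = n := by omega
      have : (U.card : ℝ) + k + 1 = n := by exact_mod_cast this
      linarith
    have e : (m:ℝ) - p * (n - U.card - 1) = d := by rw [hUc, hm]; ring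
    refine ⟨U, m, by linarith, by rw [e]; exact hd0, by rw [e]; exact hd1, ?_⟩
    intro z hzU heq
    apply hz z hzU
    rw [heq, hm]
  · filter_upwards with n
    rw [grPr_compl]
    linarith [grPr_nonneg (n := n) hp0 hp1 {G | ∀ k : ℕ,
          (n : ℝ) - (n : ℝ) ^ ((1 : ℝ) / 4) * (Real.log n) ^ 2 ≤ (k : ℝ) → k ≤ n - 2 →
          ∀ d : ℝ, 0 ≤ d → d ≤ (n : ℝ) ^ ((1 : ℝ) / 4) * (Real.log n) ^ 2 →
          (∃ m : ℕ, (m : ℝ) = p * k + d) →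
          ∀ U : Finset (Fin n), U.card = n - k - 1 →
            ∃ z : Fin n, z ∉ U ∧ (degIn G Uᶜ z : ℝ) = p * k + d}ᶜ]
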